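/- Let p be a nonnegative integer. For every (λ,τ) ∈ ℂ×ℍ with ϑ₁(λ,τ) ≠ 0, one has 2πi(2p+2) · ∂(ϑ₁^{p+1})/∂τ (λ,τ) = ∂²(ϑ₁^{p+1})/∂λ² (λ,τ) + p(p+1) ρ′(λ,τ) ϑ₁(λ,τ)^{p+1}; that is, ϑ₁^{p+1} satisfies the KZB heat equation with parameters κ = 2p+2 and p at all points where ϑ₁ does not vanish. -/

import Mathlib

open Complex

/-- The complex number π. -/
noncomputable def cπ : ℂ := Real.pi

/-- The first Jacobi theta function
`ϑ₁(λ,τ) = 2 q^{1/8} sin(πλ) ∏_{j≥1} (1-q^j e^{2πiλ})(1-q^j e^{-2πiλ})(1-q^j)`, `q = e^{2πiτ}`. -/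
noncomputable def JTheta1 (z τ : ℂ) : ℂ :=
  2 * exp (cπ * I * τ / 4) * sin (cπ * z) *
    ∏' n : ℕ, ((1 - exp (2 * cπ * I * τ) ^ (n + 1) * exp (2 * cπ * I * z)) *
      (1 - exp (2 * cπ * I * τ) ^ (n + 1) * exp (-(2 * cπ * I * z))) *
      (1 - exp (2 * cπ * I * τ) ^ (n + 1)))

/-- The Dedekind eta function `η(τ) = q^{1/24} ∏_{j≥1} (1-q^j)`, `q = e^{2πiτ}`. -/
noncomputable def DEta (τ : ℂ) : ℂ :=
  exp (cπ * I * τ / 12) * ∏' n : ℕ, (1 - exp (2 * cπ * I * τ) ^ (n + 1))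

/-- The theta function of level κ:
`θ_{κ,n}(λ,τ) = Σ_{j∈ℤ} exp(2πiκ(j+n/(2κ))²τ + 2πiκ(j+n/(2κ))λ)`. -/
noncomputable def ThetaKN (κ : ℕ) (n : ℤ) (z τ : ℂ) : ℂ :=
  ∑' j : ℤ, exp (2 * cπ * I * (κ : ℂ) * ((j : ℂ) + (n : ℂ) / (2 * (κ : ℂ))) ^ 2 * τ +
    2 * cπ * I * (κ : ℂ) * ((j : ℂ) + (n : ℂ) / (2 * (κ : ℂ))) * z)

/-- The symmetrization `θ^s_{κ,n}(λ,τ) = θ_{κ,n}(λ,τ) + θ_{κ,n}(-λ,τ)`. -/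
noncomputable def ThetaS (κ : ℕ) (n : ℤ) (z τ : ℂ) : ℂ :=
  ThetaKN κ n z τ + ThetaKN κ n (-z) τ

/-- `ρ(λ,τ) = ϑ₁'(λ,τ)/ϑ₁(λ,τ)` (derivative in the first argument). -/
noncomputable def Rho (z τ : ℂ) : ℂ :=
  deriv (fun w => JTheta1 w τ) z / JTheta1 z τ

/-- `ρ'(λ,τ)`, the derivative of `ρ` in the first argument. -/
noncomputable def Rho' (z τ : ℂ) : ℂ := deriv (fun w => Rho w τ) z

/-- `u` satisfies the KZB heat equation with parameters `κ`, `p` at `(λ,τ)`: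
`2πiκ ∂u/∂τ = ∂²u/∂λ² + p(p+1)ρ'(λ,τ)u`. -/
def KZB (κ p : ℕ) (u : ℂ → ℂ → ℂ) (z τ : ℂ) : Prop :=
  2 * cπ * I * (κ : ℂ) * deriv (fun t => u z t) τ =
    iteratedDeriv 2 (fun w => u w τ) z + (p : ℂ) * ((p : ℂ) + 1) * Rho' z τ * u z τ

open Filter Topology

/-- Gaussian binomial coefficients. -/
noncomputable def gq (q : ℂ) : ℕ → ℕ → ℂ
  | _, 0 => 1
  | 0, _ + 1 => 0
  | M + 1, m + 1 => gq q M (m + 1) + q ^ (M - m) * gq q M m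

lemma gq_zero_right (q : ℂ) (M : ℕ) : gq q M 0 = 1 := by cases M <;> rfl

lemma gq_succ (q : ℂ) (M m : ℕ) :
    gq q (M + 1) (m + 1) = gq q M (m + 1) + q ^ (M - m) * gq q M m := rfl

lemma gq_eq_zero (q : ℂ) (M : ℕ) : ∀ m, M < m → gq q M m = 0 := by
  induction M with
  | zero => intro m hm; obtain ⟨k, rfl⟩ := Nat.exists_eq_succ_of_ne_zero hm.ne'; rfl
  | succ M ih =>
    intro m hm
    obtain ⟨k, rfl⟩ := Nat.exists_eq_succ_of_ne_zero (show m ≠ 0 by omega)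
    rw [Nat.succ_eq_add_one, gq_succ, ih _ (by omega), ih _ (by omega)]; simp

lemma qbinom (q y : ℂ) (M : ℕ) :
    ∏ k ∈ Finset.range M, (1 + q ^ k * y) =
      ∑ m ∈ Finset.range (M + 1), q ^ (m.choose 2) * gq q M m * y ^ m := by
  induction M with
  | zero => simp [gq_zero_right]
  | succ M ih =>
    rw [Finset.prod_range_succ, ih, Finset.sum_range_succ' _ (M + 1), mul_add, mul_one]
    have h1 : ∑ m ∈ Finset.range (M + 1), q ^ (m.choose 2) * gq q M m * y ^ m
        = ∑ m ∈ Finset.range (M + 1), q ^ ((m + 1).choose 2) * gq q M (m + 1) * y ^ (m + 1) + 1 := by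
      have := Finset.sum_range_succ' (fun m => q ^ (m.choose 2) * gq q M m * y ^ m) (M + 1)
      rw [Finset.sum_range_succ, gq_eq_zero q M (M + 1) (by omega)] at this
      simpa [gq_zero_right] using this
    have h2 : (∑ m ∈ Finset.range (M + 1), q ^ (m.choose 2) * gq q M m * y ^ m) * (q ^ M * y)
        = ∑ m ∈ Finset.range (M + 1),
          q ^ ((m + 1).choose 2) * (q ^ (M - m) * gq q M m) * y ^ (m + 1) := by
      rw [Finset.sum_mul]
      refine Finset.sum_congr rfl fun m hm => ?_
      have hm' : m ≤ M := by simpa [Nat.lt_succ_iff] using hm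
      have : q ^ M = q ^ m * q ^ (M - m) := by rw [← pow_add]; congr 1; omega
      rw [this, Nat.choose_succ_succ' m 1, Nat.choose_one_right, pow_add]
      ring
    rw [h2]
    nth_rewrite 1 [h1]
    simp only [gq_succ, gq_zero_right, Nat.choose_zero_succ, pow_zero, mul_one, mul_add, add_mul,
      Finset.sum_add_distrib]
    ring

/-- Partial Euler product. -/
noncomputable def pq (q : ℂ) (n : ℕ) : ℂ := ∏ k ∈ Finset.range n, (1 - q ^ (k + 1))

lemma pq_succ (q : ℂ) (n : ℕ) : pq q (n + 1) = pq q n * (1 - q ^ (n + 1)) :=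
  Finset.prod_range_succ _ _

lemma gq_mul (q : ℂ) (M : ℕ) : ∀ m k, m + k = M → gq q M m * (pq q m * pq q k) = pq q M := by
  induction M with
  | zero =>
    intro m k h
    obtain ⟨rfl, rfl⟩ : m = 0 ∧ k = 0 := by omega
    simp [gq_zero_right, pq]
  | succ M ih =>
    intro m k h
    rcases m with _ | m
    · obtain rfl : k = M + 1 := by omega
      simp [gq_zero_right, pq]
    rcases k with _ | k
    · obtain rfl : m = M := by omega
      have := ih m 0 (by omega)
      rw [gq_succ, gq_eq_zero q m (m + 1) (by omega), pq_succ]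
      simp only [Nat.sub_self, pow_zero, one_mul, zero_add]
      linear_combination (1 - q ^ (m + 1)) * this
    · have h1 := ih (m + 1) k (by omega)
      have h2 := ih m (k + 1) (by omega)
      have e : M - m = k + 1 := by omega
      have e2 : M = m + (k + 1) := by omega
      rw [gq_succ, e, pq_succ q M]
      have h3 : pq q (m + 1) = pq q m * (1 - q ^ (m + 1)) := pq_succ q m
      have h4 : pq q (k + 1) = pq q k * (1 - q ^ (k + 1)) := pq_succ q k
      have h5 : q ^ (M + 1) = q ^ (k + 1) * q ^ (m + 1) := by rw [← pow_add]; congr 1; omega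
      rw [h5]
      linear_combination (1 - q ^ (k + 1)) * h1 + q ^ (k + 1) * (1 - q ^ (m + 1)) * h2 +
        gq q M (m + 1) * pq q (m + 1) * h4 + q ^ (k + 1) * gq q M m * pq q (k + 1) * h3

/-- Finite triple product, in exponential form. -/
lemma finite_triple (T X : ℂ) (N : ℕ) :
    ∏ k ∈ Finset.range N, ((1 + exp T ^ (k + 1) * exp X) * (1 + exp T ^ k * exp (-X))) =
      ∑ n ∈ Finset.Icc (-(N : ℤ)) N, gq (exp T) (2 * N) ((N : ℤ) + n).toNat *
        exp (T * (n * (n + 1) / 2) + n * X) := by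
  have key := qbinom (exp T) (exp (X + (1 - N) * T)) (2 * N)
  rw [two_mul, Finset.prod_range_add, ← Finset.prod_range_reflect, ← two_mul] at key
  have hA : ∏ k ∈ Finset.range N, (1 + exp T ^ (N - 1 - k) * exp (X + (1 - N) * T)) =
      (∏ k ∈ Finset.range N, (1 + exp T ^ k * exp (-X))) *
        exp (N * X - (N * (N - 1) / 2) * T) := by
    have : ∀ K : ℕ, exp (K * X - (K * (K - 1) / 2) * T)
        = ∏ k ∈ Finset.range K, exp (X - k * T) := by
      intro K
      rw [← Complex.exp_sum, Finset.sum_sub_distrib, ← Finset.sum_mul]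
      congr 2
      · simp
      · congr 1
        induction K with
        | zero => simp
        | succ K ih => rw [Finset.sum_range_succ, ← ih]; push_cast; ring
    rw [this, ← Finset.prod_mul_distrib]
    refine Finset.prod_congr rfl fun k hk => ?_
    have hk' : k + 1 ≤ N := by simpa using hk
    have hc : ((N - 1 - k : ℕ) : ℂ) = N - 1 - k := by
      rw [Nat.sub_sub, Nat.cast_sub (by omega)]; push_cast; ring
    rw [← exp_nat_mul, ← exp_nat_mul, hc, ← exp_add, ← exp_add, add_mul, ← exp_add, one_mul]
    rw [add_comm, show (k : ℂ) * T + -X + (X - k * T) = 0 by ring, exp_zero]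
    congr 2; ring
  have hB : ∏ k ∈ Finset.range N, (1 + exp T ^ (N + k) * exp (X + (1 - N) * T)) =
      ∏ k ∈ Finset.range N, (1 + exp T ^ (k + 1) * exp X) := by
    refine Finset.prod_congr rfl fun k hk => ?_
    rw [← exp_nat_mul, ← exp_nat_mul, ← exp_add, ← exp_add]
    congr 2; push_cast; ring
  rw [hA, hB] at key
  have hne := exp_ne_zero (N * X - (N * (N - 1) / 2) * T)
  rw [Finset.prod_mul_distrib]
  apply mul_right_cancel₀ hne
  rw [show ∀ a b c : ℂ, a * b * c = b * c * a by intros; ring, key, Finset.sum_mul]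
  refine Finset.sum_nbij' (fun m : ℕ => (m : ℤ) - N) (fun n : ℤ => ((N : ℤ) + n).toNat)
    ?_ ?_ ?_ ?_ ?_
  · intro m hm; simp at hm ⊢; omega
  · intro n hn; simp at hn ⊢; omega
  · intro m hm; simp
  · intro n hn; simp at hn ⊢; omega
  · intro m hm
    have : ((N : ℤ) + ((m : ℤ) - N)).toNat = m := by omega
    simp only [this]
    rw [← exp_nat_mul, ← exp_nat_mul, Nat.cast_choose_two, mul_assoc (gq _ _ _), ← exp_add,
      mul_right_comm, ← exp_add, mul_comm]
    congr 2; push_cast; ring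

lemma pq_tendsto {q : ℂ} (hq : ‖q‖ < 1) :
    Tendsto (pq q) atTop (𝓝 (∏' n : ℕ, (1 - q ^ (n + 1)))) :=
  (ModularForm.multipliable_one_sub_pow hq).hasProd.tendsto_prod_nat

lemma one_sub_pow_ne {q : ℂ} (hq : ‖q‖ < 1) (n : ℕ) : 1 - q ^ (n + 1) ≠ 0 := by
  intro h
  have h1 : ‖q ^ (n + 1)‖ = 1 := by rw [← sub_eq_zero.mp h]; simp
  rw [norm_pow] at h1
  exact (pow_lt_one₀ (norm_nonneg _) hq (by omega)).ne h1

lemma pq_ne {q : ℂ} (hq : ‖q‖ < 1) (n : ℕ) : pq q n ≠ 0 :=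
  Finset.prod_ne_zero_iff.mpr fun k _ => one_sub_pow_ne hq k

lemma summable_q {q : ℂ} (hq : ‖q‖ < 1) (x : ℂ) : Summable fun n : ℕ => ‖q ^ (n + 1) * x‖ := by
  simp only [norm_mul, norm_pow]
  exact ((summable_nat_add_iff 1).mpr
    (summable_geometric_of_lt_one (norm_nonneg _) hq)).mul_right _

lemma tprod_ne {q : ℂ} (hq : ‖q‖ < 1) : ∏' n : ℕ, (1 - q ^ (n + 1)) ≠ 0 := by
  have := tprod_one_add_ne_zero_of_summable (f := fun n : ℕ => -q ^ (n + 1))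
    (fun n => by simpa [← sub_eq_add_neg] using one_sub_pow_ne hq n)
    (by simpa using summable_q hq 1)
  simpa [← sub_eq_add_neg] using this

lemma multipliable_q {q : ℂ} (hq : ‖q‖ < 1) (x : ℂ) :
    Multipliable fun n : ℕ => 1 + q ^ (n + 1) * x :=
  multipliable_one_add_of_summable (summable_q hq x)

/-- Jacobi triple product, in exponential form. -/
lemma triple (T X : ℂ) (hq : ‖exp T‖ < 1)
    (hs : Summable fun n : ℤ => exp (T * (n * (n + 1) / 2) + n * X)) :
    (1 + exp (-X)) * ((∏' n : ℕ, (1 + exp T ^ (n + 1) * exp X)) *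
      (∏' n : ℕ, (1 + exp T ^ (n + 1) * exp (-X))) * ∏' n : ℕ, (1 - exp T ^ (n + 1))) =
      ∑' n : ℤ, exp (T * (n * (n + 1) / 2) + n * X) := by
  set q := exp T with hqd
  set t : ℤ → ℂ := fun n => exp (T * (n * (n + 1) / 2) + n * X) with ht
  set P := ∏' n : ℕ, (1 - q ^ (n + 1)) with hP
  have hP0 : P ≠ 0 := tprod_ne hq
  have hlim := pq_tendsto hq
  have hlimi : Tendsto (fun n => (pq q n)⁻¹) atTop (𝓝 P⁻¹) := hlim.inv₀ hP0
  obtain ⟨C, hC⟩ := (Metric.isBounded_range_of_tendsto _ hlim).exists_norm_le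
  obtain ⟨D, hD⟩ := (Metric.isBounded_range_of_tendsto _ hlimi).exists_norm_le
  have hC' : ∀ n, ‖pq q n‖ ≤ C := fun n => hC _ ⟨n, rfl⟩
  have hD' : ∀ n, ‖(pq q n)⁻¹‖ ≤ D := fun n => hD _ ⟨n, rfl⟩
  have hC0 : 0 ≤ C := (norm_nonneg _).trans (hC' 0)
  have hD0 : 0 ≤ D := (norm_nonneg _).trans (hD' 0)
  have hg : ∀ (N : ℕ) (n : ℤ), n ∈ Finset.Icc (-(N : ℤ)) N → gq q (2 * N) ((N : ℤ) + n).toNat =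
      pq q (2 * N) * ((pq q ((N : ℤ) + n).toNat)⁻¹ * (pq q ((N : ℤ) - n).toNat)⁻¹) := by
    intro N n hn
    have hn' := Finset.mem_Icc.mp hn
    have := gq_mul q (2 * N) ((N : ℤ) + n).toNat ((N : ℤ) - n).toNat (by omega)
    rw [← this]
    have h1 := pq_ne hq ((N : ℤ) + n).toNat
    have h2 := pq_ne hq ((N : ℤ) - n).toNat
    field_simp
  let f : ℕ → ℤ → ℂ := fun N n =>
    if n ∈ Finset.Icc (-(N : ℤ)) N then gq q (2 * N) ((N : ℤ) + n).toNat * t n else 0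
  have hsumf : ∀ N, ∑' n, f N n = ∏ k ∈ Finset.range N,
      ((1 + q ^ (k + 1) * exp X) * (1 + q ^ k * exp (-X))) := by
    intro N
    rw [finite_triple, tsum_eq_sum (s := Finset.Icc (-(N : ℤ)) N)]
    · exact Finset.sum_congr rfl fun n hn => by simp only [f, if_pos hn, ht, hqd]
    · intro n hn; simp only [f, if_neg hn]
  have hT : Tendsto (fun N => ∑' n, f N n) atTop (𝓝 (∑' n, P⁻¹ * t n)) := by
    refine tendsto_tsum_of_dominated_convergence (bound := fun n => C * (D * D) * ‖t n‖)
      (hs.norm.mul_left _) ?_ ?_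
    · intro n
      have e1 : Tendsto (fun N : ℕ => ((N : ℤ) + n).toNat) atTop atTop :=
        tendsto_atTop.mpr fun b => by
          filter_upwards [eventually_ge_atTop (b + n.natAbs)] with N hN; omega
      have e2 : Tendsto (fun N : ℕ => ((N : ℤ) - n).toNat) atTop atTop :=
        tendsto_atTop.mpr fun b => by
          filter_upwards [eventually_ge_atTop (b + n.natAbs)] with N hN; omega
      have e3 : Tendsto (fun N : ℕ => 2 * N) atTop atTop :=
        tendsto_atTop.mpr fun b => by
          filter_upwards [eventually_ge_atTop b] with N hN; omega
      have L := ((hlim.comp e3).mul ((hlimi.comp e1).mul (hlimi.comp e2))).mul_const (t n)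
      have : P * (P⁻¹ * P⁻¹) * t n = P⁻¹ * t n := by field_simp
      rw [← this]
      refine L.congr' ?_
      filter_upwards [eventually_ge_atTop n.natAbs] with N hN
      have hn : n ∈ Finset.Icc (-(N : ℤ)) N := by rw [Finset.mem_Icc]; omega
      simp only [f, if_pos hn, hg N n hn, Function.comp]
    · refine Eventually.of_forall fun N n => ?_
      by_cases hn : n ∈ Finset.Icc (-(N : ℤ)) N
      · simp only [f, if_pos hn, hg N n hn, norm_mul]
        gcongr
        · exact hC' _
        · exact hD' _
        · exact hD' _
      · simp only [f, if_neg hn, norm_zero]; positivity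
  have hT2 : Tendsto (fun N => (∑' n, f N n) * (1 + q ^ N * exp (-X))) atTop
      (𝓝 ((1 + exp (-X)) * ((∏' n : ℕ, (1 + q ^ (n + 1) * exp X)) *
      (∏' n : ℕ, (1 + q ^ (n + 1) * exp (-X)))))) := by
    have L := ((multipliable_q hq (exp X)).hasProd.tendsto_prod_nat.mul
      (multipliable_q hq (exp (-X))).hasProd.tendsto_prod_nat).const_mul (1 + exp (-X))
    refine L.congr fun N => ?_
    rw [hsumf, Finset.prod_mul_distrib, mul_assoc, ← Finset.prod_range_succ
      (fun k => 1 + q ^ k * exp (-X)), Finset.prod_range_succ']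
    simp only [pow_zero, one_mul]; ring
  have hT3 : Tendsto (fun N => (∑' n, f N n) * (1 + q ^ N * exp (-X))) atTop
      (𝓝 ((∑' n, P⁻¹ * t n) * (1 + 0 * exp (-X)))) :=
    hT.mul (((tendsto_pow_atTop_nhds_zero_of_norm_lt_one hq).mul_const _).const_add _)
  have := tendsto_nhds_unique hT2 hT3
  rw [tsum_mul_left] at this
  rw [← mul_assoc, this]
  field_simp
  ring

lemma JTheta1_eq (z τ : ℂ) (hτ : 0 < τ.im) :
    JTheta1 z τ = -I * exp (Real.pi * I * z + Real.pi * I * τ / 4) *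
      jacobiTheta₂ (z + τ / 2 + 1 / 2) τ := by
  have hq : ‖exp (2 * cπ * I * τ)‖ < 1 := by
    have := UpperHalfPlane.norm_exp_two_pi_I_lt_one ⟨τ, hτ⟩
    simpa [cπ] using this
  set q := exp (2 * cπ * I * τ) with hqd
  have hx : exp (2 * cπ * I * z + cπ * I) = -exp (2 * cπ * I * z) := by
    rw [exp_add, cπ, exp_pi_mul_I]; ring
  have hx' : exp (-(2 * cπ * I * z + cπ * I)) = -exp (-(2 * cπ * I * z)) := by
    rw [exp_neg, hx, exp_neg, inv_neg]
  have hterm : ∀ n : ℤ, exp (2 * cπ * I * τ * (n * (n + 1) / 2) + n * (2 * cπ * I * z + cπ * I)) =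
      jacobiTheta₂_term n (z + τ / 2 + 1 / 2) τ := by
    intro n
    rw [jacobiTheta₂_term, cπ]; congr 1; ring
  have key := triple (2 * cπ * I * τ) (2 * cπ * I * z + cπ * I) hq (by
    simp only [hterm]; exact (summable_jacobiTheta₂_term_iff _ _).mpr hτ)
  simp only [hterm] at key
  rw [jacobiTheta₂, ← key, JTheta1, ← hqd, hx, hx']
  have m1 := multipliable_q hq (-exp (2 * cπ * I * z))
  have m2 := multipliable_q hq (-exp (-(2 * cπ * I * z)))
  have m3 := ModularForm.multipliable_one_sub_pow hq
  rw [← m1.tprod_mul m2, ← (m1.mul m2).tprod_mul m3]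
  simp only [mul_neg, ← sub_eq_add_neg]
  rw [← mul_assoc]
  congr 1
  have e : exp (-(2 * cπ * I * z)) = exp (-(cπ * z) * I) * exp (-(cπ * z) * I) := by
    rw [← exp_add]; congr 1; ring
  have e' : exp (cπ * z * I) * exp (-(cπ * z) * I) = 1 := by
    rw [← exp_add]; simp
  rw [Complex.sin, e, exp_add, ← cπ, show cπ * I * z = cπ * z * I by ring]
  linear_combination (-I * exp (cπ * I * τ / 4) * exp (-(cπ * z) * I)) * e'

/-- Second `z`-derivative of the two-variable theta function. -/
noncomputable def theta2zz (z τ : ℂ) : ℂ :=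
  ∑' n : ℤ, (2 * Real.pi * I * n) ^ 2 * jacobiTheta₂_term n z τ

lemma hasDerivAt_theta' (z : ℂ) {τ : ℂ} (hτ : 0 < τ.im) :
    HasDerivAt (fun w => jacobiTheta₂' w τ) (theta2zz z τ) z := by
  have hd : ∀ (n : ℤ) (w : ℂ), HasDerivAt (fun w => jacobiTheta₂'_term n w τ)
      ((2 * Real.pi * I * n) ^ 2 * jacobiTheta₂_term n w τ) w := by
    intro n w
    have h1 : HasDerivAt (fun w : ℂ => 2 * Real.pi * I * n * w + Real.pi * I * n ^ 2 * τ)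
        (2 * Real.pi * I * n) w := by
      simpa using ((hasDerivAt_id w).const_mul (2 * Real.pi * I * n : ℂ)).add_const
        (Real.pi * I * n ^ 2 * τ)
    have h2 := h1.cexp.const_mul (2 * Real.pi * I * n : ℂ)
    simp only [jacobiTheta₂'_term, jacobiTheta₂_term]
    exact h2.congr_deriv (by ring)
  let S := |z.im| + 1
  have hopen : IsOpen {w : ℂ | |w.im| < S} :=
    isOpen_lt (by fun_prop) continuous_const
  have hz : z ∈ {w : ℂ | |w.im| < S} := by simp [S]
  have hu : Summable fun n : ℤ =>
      2 * Real.pi * (|(n : ℝ)| ^ 1 * Real.exp (-Real.pi * (τ.im * n ^ 2 - 2 * S * |(n : ℝ)|))) := by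
    have := (summable_pow_mul_jacobiTheta₂_term_bound S hτ 1).mul_left (2 * Real.pi)
    simpa using this
  have hle : ∀ (n : ℤ) (w : ℂ), w ∈ {w : ℂ | |w.im| < S} → ‖jacobiTheta₂'_term n w τ‖ ≤
      2 * Real.pi * (|(n : ℝ)| ^ 1 * Real.exp (-Real.pi * (τ.im * n ^ 2 - 2 * S * |(n : ℝ)|))) := by
    intro n w hw
    have := norm_jacobiTheta₂'_term_le hτ (le_of_lt hw) le_rfl n
    rw [pow_one, ← mul_assoc]; simpa using this
  have hdo : ∀ n : ℤ, DifferentiableOn ℂ (fun w => jacobiTheta₂'_term n w τ)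
      {w : ℂ | |w.im| < S} :=
    fun n w _ => (hd n w).differentiableAt.differentiableWithinAt
  have hs := hasSum_deriv_of_summable_norm hu hdo hopen hle hz
  have hD := (differentiableOn_tsum_of_summable_norm hu hdo hopen hle).differentiableAt
    (hopen.mem_nhds hz)
  have hv := hD.hasDerivAt
  rw [← hs.tsum_eq] at hv
  simp only [(hd _ _).deriv] at hv
  exact hv

lemma heat_theta2 (z : ℂ) {τ : ℂ} (hτ : 0 < τ.im) :
    4 * Real.pi * I * jacobiTheta₂_fderiv z τ (0, 1) = theta2zz z τ ∧
    jacobiTheta₂_fderiv z τ (1, 0) = jacobiTheta₂' z τ := by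
  have h := hasSum_jacobiTheta₂_term_fderiv z hτ
  have h1 := (h.mapL (ContinuousLinearMap.apply ℂ ℂ ((0, 1) : ℂ × ℂ))).tsum_eq
  have h2 := (h.mapL (ContinuousLinearMap.apply ℂ ℂ ((1, 0) : ℂ × ℂ))).tsum_eq
  simp only [ContinuousLinearMap.apply_apply] at h1 h2
  rw [← h1, ← h2, theta2zz, jacobiTheta₂', ← tsum_mul_left]
  constructor
  · refine tsum_congr fun n => ?_
    simp [jacobiTheta₂_term_fderiv, jacobiTheta₂_term]
    ring_nf
  · refine tsum_congr fun n => ?_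
    simp [jacobiTheta₂_term_fderiv, jacobiTheta₂_term, jacobiTheta₂'_term]
    ring

lemma JTheta1_heat (τ : ℂ) (hτ : 0 < τ.im) : ∃ f1 f2 : ℂ → ℂ, ∃ g : ℂ → ℂ,
    (∀ z, HasDerivAt (fun w => JTheta1 w τ) (f1 z) z) ∧ (∀ z, HasDerivAt f1 (f2 z) z) ∧
    (∀ z, HasDerivAt (fun t => JTheta1 z t) (g z) τ) ∧
    (∀ z, 4 * cπ * I * g z = f2 z) := by
  let E : ℂ → ℂ → ℂ := fun z t => -I * exp (Real.pi * I * z + Real.pi * I * t / 4)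
  let s : ℂ → ℂ → ℂ := fun z t => z + t / 2 + 1 / 2
  have hEz : ∀ z, HasDerivAt (fun w => E w τ) (Real.pi * I * E z τ) z := by
    intro z
    have h1 : HasDerivAt (fun w : ℂ => Real.pi * I * w + Real.pi * I * τ / 4)
        (Real.pi * I) z := by
      simpa using ((hasDerivAt_id z).const_mul (Real.pi * I : ℂ)).add_const (Real.pi * I * τ / 4)
    exact (h1.cexp.const_mul (-I)).congr_deriv (by simp only [E]; ring)
  have hEt : ∀ z, HasDerivAt (fun t => E z t) (Real.pi * I / 4 * E z τ) τ := by
    intro z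
    have h1 : HasDerivAt (fun t : ℂ => Real.pi * I * z + Real.pi * I * t / 4)
        (Real.pi * I / 4) τ := by
      simpa using (((hasDerivAt_id τ).const_mul (Real.pi * I : ℂ)).div_const 4).const_add
        (Real.pi * I * z)
    exact (h1.cexp.const_mul (-I)).congr_deriv (by simp only [E]; ring)
  have hsz : ∀ z, HasDerivAt (fun w => s w τ) 1 z := fun z =>
    ((hasDerivAt_id z).add_const (τ / 2)).add_const (1 / 2)
  have hst : ∀ z, HasDerivAt (fun t => s z t) (1 / 2) τ := fun z =>
    (((hasDerivAt_id τ).div_const 2).const_add z).add_const (1 / 2)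
  have hth : ∀ z, HasDerivAt (fun w => jacobiTheta₂ (s w τ) τ) (jacobiTheta₂' (s z τ) τ) z := by
    intro z
    exact ((hasDerivAt_jacobiTheta₂_fst (s z τ) hτ).comp z (hsz z)).congr_deriv (mul_one _)
  have hth' : ∀ z, HasDerivAt (fun w => jacobiTheta₂' (s w τ) τ) (theta2zz (s z τ) τ) z := by
    intro z
    exact ((hasDerivAt_theta' (s z τ) hτ).comp z (hsz z)).congr_deriv (mul_one _)
  have htt : ∀ z, HasDerivAt (fun t => jacobiTheta₂ (s z t) t)
      (jacobiTheta₂_fderiv (s z τ) τ (1 / 2, 1)) τ := by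
    intro z
    exact HasFDerivAt.comp_hasDerivAt (f := fun t => (s z t, t)) τ
      (hasFDerivAt_jacobiTheta₂ (s z τ) hτ) ((hst z).prodMk (hasDerivAt_id' τ))
  refine ⟨fun z => Real.pi * I * E z τ * jacobiTheta₂ (s z τ) τ + E z τ * jacobiTheta₂' (s z τ) τ,
    fun z => (Real.pi * I * (Real.pi * I * E z τ)) * jacobiTheta₂ (s z τ) τ +
      Real.pi * I * E z τ * jacobiTheta₂' (s z τ) τ + (Real.pi * I * E z τ * jacobiTheta₂' (s z τ) τ
      + E z τ * theta2zz (s z τ) τ),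
    fun z => Real.pi * I / 4 * E z τ * jacobiTheta₂ (s z τ) τ +
      E z τ * jacobiTheta₂_fderiv (s z τ) τ (1 / 2, 1), ?_, ?_, ?_, ?_⟩
  · intro z
    have : (fun w => JTheta1 w τ) = fun w => E w τ * jacobiTheta₂ (s w τ) τ :=
      funext fun w => JTheta1_eq w τ hτ
    rw [this]
    exact (hEz z).mul (hth z)
  · intro z
    exact (((hEz z).const_mul _).mul (hth z)).add ((hEz z).mul (hth' z))
  · intro z
    have : (fun t => JTheta1 z t) =ᶠ[𝓝 τ] fun t => E z t * jacobiTheta₂ (s z t) t := by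
      filter_upwards [(isOpen_lt continuous_const continuous_im).mem_nhds hτ] with t ht
      exact JTheta1_eq z t ht
    exact ((hEt z).mul (htt z)).congr_of_eventuallyEq this
  · intro z
    obtain ⟨h1, h2⟩ := heat_theta2 (s z τ) hτ
    have h3 : jacobiTheta₂_fderiv (s z τ) τ (1 / 2, 1) =
        1 / 2 * jacobiTheta₂' (s z τ) τ + jacobiTheta₂_fderiv (s z τ) τ (0, 1) := by
      rw [← h2, ← smul_eq_mul, ← map_smul, ← map_add]
      simp
    simp only [h3, cπ]
    rw [← h1]
    ring

/-- `ϑ₁^{p+1}` satisfies the KZB heat equation with parameters `κ = 2p+2` and `p` at all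
points `(λ,τ) ∈ ℂ×ℍ` where `ϑ₁(λ,τ) ≠ 0`:
`2πi(2p+2) ∂(ϑ₁^{p+1})/∂τ = ∂²(ϑ₁^{p+1})/∂λ² + p(p+1)ρ'(λ,τ)ϑ₁(λ,τ)^{p+1}`. -/
theorem jtheta1_pow_KZB (p : ℕ) (z τ : ℂ) (hτ : 0 < τ.im) (h0 : JTheta1 z τ ≠ 0) :
    KZB (2 * p + 2) p (fun w t => JTheta1 w t ^ (p + 1)) z τ := by
  obtain ⟨f1, f2, g, hf1, hf2, hg, hh⟩ := JTheta1_heat τ hτ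
  have hh := hh z
  have d1 : deriv (fun t => JTheta1 z t ^ (p + 1)) τ = (p + 1) * JTheta1 z τ ^ p * g z := by
    simpa using ((hg z).fun_pow (p + 1)).deriv
  have d2 : deriv (fun w => JTheta1 w τ ^ (p + 1)) =
      fun w => (p + 1) * JTheta1 w τ ^ p * f1 w := by
    funext w
    simpa using ((hf1 w).fun_pow (p + 1)).deriv
  have d3 : iteratedDeriv 2 (fun w => JTheta1 w τ ^ (p + 1)) z =
      (p + 1) * (p * JTheta1 z τ ^ (p - 1) * f1 z) * f1 z + (p + 1) * JTheta1 z τ ^ p * f2 z := by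
    rw [iteratedDeriv_succ, iteratedDeriv_one, d2]
    exact ((((hf1 z).pow p).const_mul ((p : ℂ) + 1)).mul (hf2 z)).deriv
  have d4 : Rho' z τ = (f2 z * JTheta1 z τ - f1 z * f1 z) / JTheta1 z τ ^ 2 := by
    have : (fun w => Rho w τ) = fun w => f1 w / JTheta1 w τ :=
      funext fun w => by rw [Rho, (hf1 w).deriv]
    rw [Rho', this]
    exact ((hf2 z).div (hf1 z) h0).deriv
  unfold KZB
  simp only []
  rw [d1, d3, d4]
  rw [← hh]
  rcases p with _ | p
  · simp only [Nat.cast_zero, Nat.mul_zero]; push_cast; ring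
  · simp only [Nat.add_sub_cancel]
    push_cast
    field_simp
    ring
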